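/- arXiv:math/9806138 — 5 statements merged into one kernel-verified Lean document; each statement's English description precedes it below -/
import Mathlib

section
/- Let n ≥ 2 and N ≥ 1 be integers and let ν_1 ≥ ν_2 ≥ … ≥ ν_N ≥ 1 be integers satisfying the two equalities n² = (Σ_{i=1}^N ν_i²) + 1 and (n−1)(n−2) = Σ_{i=1}^N ν_i(ν_i − 1). Then N ≥ 3 and the three greatest multiplicities satisfy Noether's inequality ν_1 + ν_2 + ν_3 > n. -/
/-- The arithmetic estimate behind Noether's inequality: if `a ≥ b ≥ c ≥ 1` and `a + b + c ≤ n`,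
then the maximum of `a (a - c) + b (b - c) + 3 c (n - 1)` stays below `n² - 1`. -/
lemma mul_sub_add_mul_sub_lt {n a b c : ℤ} (hc : 1 ≤ c) (hcb : c ≤ b) (hba : b ≤ a)
    (h : a + b + c ≤ n) :
    a * (a - c) + b * (b - c) + 3 * c * (n - 1) < n ^ 2 - 1 := by
  have hab : a * (a - c) + b * (b - c) ≤ (a + b - c) * (a + b - 2 * c) := by
    nlinarith [mul_nonneg (sub_nonneg.2 hcb) (sub_nonneg.2 (hcb.trans hba))]
  have hn : (a + b - c) * (a + b - 2 * c) ≤ (n - 2 * c) * (n - 3 * c) :=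
    mul_le_mul (by linarith) (by linarith) (by linarith) (by linarith)
  nlinarith [mul_nonneg (zero_le_one.trans hc) (show 0 ≤ n - 3 * c by linarith)]

/-- **Noether's inequality** (arithmetic core of Noether's theorem on `Cr P²`).
If `n ≥ 2`, `N ≥ 1`, and `ν 1 ≥ ν 2 ≥ … ≥ ν N ≥ 1` are integers satisfying
`n² = (∑ νᵢ²) + 1` and `(n−1)(n−2) = ∑ νᵢ(νᵢ−1)`, then `N ≥ 3` and
`ν 1 + ν 2 + ν 3 > n`. -/
theorem noether_inequality
    (n : ℤ) (hn : 2 ≤ n)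
    (N : ℕ) (hN : 1 ≤ N)
    (ν : ℕ → ℤ)
    (hpos : ∀ i, 1 ≤ i → i ≤ N → 1 ≤ ν i)
    (hmono : ∀ i j, 1 ≤ i → i ≤ j → j ≤ N → ν j ≤ ν i)
    (heq1 : n ^ 2 = (∑ i ∈ Finset.Icc 1 N, (ν i) ^ 2) + 1)
    (heq2 : (n - 1) * (n - 2) = ∑ i ∈ Finset.Icc 1 N, ν i * (ν i - 1)) :
    3 ≤ N ∧ ν 1 + ν 2 + ν 3 > n := by
  have hsum : ∑ i ∈ Finset.Icc 1 N, ν i = 3 * (n - 1) := by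
    have h : ∑ i ∈ Finset.Icc 1 N, ν i * (ν i - 1) =
        ∑ i ∈ Finset.Icc 1 N, ν i ^ 2 - ∑ i ∈ Finset.Icc 1 N, ν i := by
      rw [← Finset.sum_sub_distrib]
      exact Finset.sum_congr rfl fun i _ => by ring
    linarith
  have hlt : ∀ i ∈ Finset.Icc 1 N, ν i ≤ n - 1 := by
    intro i hi
    have h := Finset.single_le_sum (f := fun i => ν i ^ 2) (fun j _ => sq_nonneg (ν j)) hi
    have : ν i < n := lt_of_pow_lt_pow_left₀ 2 (by linarith) (by linarith)
    linarith
  have hN3 : 3 ≤ N := by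
    have h := Finset.sum_le_card_nsmul _ _ _ hlt
    rw [hsum, Nat.card_Icc, Nat.add_sub_cancel, nsmul_eq_mul] at h
    exact_mod_cast le_of_mul_le_mul_right h (by linarith)
  refine ⟨hN3, ?_⟩
  by_contra! hle
  have htail : ∑ i ∈ Finset.Icc 1 N, ν i * (ν i - ν 3) ≤
      ν 1 * (ν 1 - ν 3) + ν 2 * (ν 2 - ν 3) := by
    have hsub : ({1, 2} : Finset ℕ) ⊆ Finset.Icc 1 N := by
      intro i hi
      simp only [Finset.mem_insert, Finset.mem_singleton] at hi
      exact Finset.mem_Icc.2 (by omega)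
    rw [← Finset.sum_sdiff hsub, Finset.sum_pair (by norm_num)]
    refine add_le_of_nonpos_left (Finset.sum_nonpos fun i hi => ?_)
    simp only [Finset.mem_sdiff, Finset.mem_Icc, Finset.mem_insert, Finset.mem_singleton] at hi
    exact mul_nonpos_of_nonneg_of_nonpos (zero_le_one.trans (hpos i hi.1.1 hi.1.2))
      (sub_nonpos.2 (hmono 3 i (by norm_num) (by omega) hi.1.2))
  have hexpand : ∑ i ∈ Finset.Icc 1 N, ν i * (ν i - ν 3) = n ^ 2 - 1 - 3 * ν 3 * (n - 1) := by
    have h : ∑ i ∈ Finset.Icc 1 N, ν i * (ν i - ν 3) =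
        ∑ i ∈ Finset.Icc 1 N, ν i ^ 2 - ν 3 * ∑ i ∈ Finset.Icc 1 N, ν i := by
      rw [Finset.mul_sum, ← Finset.sum_sub_distrib]
      exact Finset.sum_congr rfl fun i _ => by ring
    rw [h, hsum, heq1]
    ring
  linarith [mul_sub_add_mul_sub_lt (hpos 3 (by norm_num) hN3)
    (hmono 2 3 (by norm_num) (by norm_num) hN3)
    (hmono 1 2 (by norm_num) (by norm_num) (by omega)) hle]
end

section
/- Assume given resolution data: integers K ≥ L ≥ 1; a relation → on {1,…,K}; real numbers ν_1,…,ν_K; nonnegative real numbers d_1,…,d_L; and nonnegative real numbers m_{i,j} for 0 ≤ i < j ≤ L, such that (i) ν_j² + d_j = Σ_{i=0}^{j−1} m_{i,j} for each 1 ≤ j ≤ L, (ii) m_{i,j} ≤ d_i whenever 1 ≤ i < j ≤ L, (iii) whenever 1 ≤ i < j ≤ L and m_{i,j} > 0 one has j → i, and (iv) d_L ≥ Σ_{i=L+1}^K ν_i². Let a : {1,…,L} → ℝ be any nonnegative function compatible with the graph structure, i.e. a(i) ≥ Σ_{j ∈ {1,…,L}, j → i} a(j) for every i ∈ {1,…,L}.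 Then Σ_{i=1}^L a(i)·m_{0,i} ≥ Σ_{i=1}^L a(i)·ν_i² + a(L)·Σ_{i=L+1}^K ν_i². -/
open Finset

/-- **The principal computation** of the method of maximal singularities
(abstract numerical form). Given resolution data: `K ≥ L ≥ 1`, a relation `→`
(`arrow`) on `{1,…,K}`, reals `ν₁,…,ν_K`, nonnegative reals `d₁,…,d_L`, and
nonnegative reals `m_{i,j}` for `0 ≤ i < j ≤ L`, satisfying
(i) `ν_j² + d_j = ∑_{i=0}^{j−1} m_{i,j}` for `1 ≤ j ≤ L`,
(ii) `m_{i,j} ≤ d_i` for `1 ≤ i < j ≤ L`,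
(iii) `m_{i,j} > 0 → j → i` for `1 ≤ i < j ≤ L`,
(iv) `d_L ≥ ∑_{i=L+1}^{K} ν_i²`,
then for any nonnegative function `a` on `{1,…,L}` compatible with the graph
structure (`a i ≥ ∑_{j → i} a j`), one has
`∑_{i=1}^{L} a i · m_{0,i} ≥ ∑_{i=1}^{L} a i · ν_i² + a L · ∑_{i=L+1}^{K} ν_i²`. -/
theorem principal_computation
    (K L : ℕ) (hL : 1 ≤ L) (hKL : L ≤ K)
    (arrow : ℕ → ℕ → Prop) [DecidableRel arrow]
    (ν : ℕ → ℝ) (d : ℕ → ℝ) (mlt : ℕ → ℕ → ℝ)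
    (hd : ∀ i, 1 ≤ i → i ≤ L → 0 ≤ d i)
    (hmlt : ∀ i j, i < j → j ≤ L → 0 ≤ mlt i j)
    (hyp1 : ∀ j, 1 ≤ j → j ≤ L →
      ν j ^ 2 + d j = ∑ i ∈ Finset.range j, mlt i j)
    (hyp2 : ∀ i j, 1 ≤ i → i < j → j ≤ L → mlt i j ≤ d i)
    (hyp3 : ∀ i j, 1 ≤ i → i < j → j ≤ L → 0 < mlt i j → arrow j i)
    (hyp4 : d L ≥ ∑ i ∈ Finset.Icc (L + 1) K, ν i ^ 2)
    (a : ℕ → ℝ)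
    (ha : ∀ i, 1 ≤ i → i ≤ L → 0 ≤ a i)
    (hcomp : ∀ i, 1 ≤ i → i ≤ L →
      a i ≥ ∑ j ∈ (Finset.Icc 1 L).filter (fun j => arrow j i), a j) :
    ∑ i ∈ Finset.Icc 1 L, a i * mlt 0 i ≥
      ∑ i ∈ Finset.Icc 1 L, a i * ν i ^ 2 +
        a L * ∑ i ∈ Finset.Icc (L + 1) K, ν i ^ 2 := by
  have swap : ∑ j ∈ Icc 1 L, ∑ i ∈ Ico 1 j, a j * mlt i j =
      ∑ i ∈ Ico 1 L, ∑ j ∈ Ioc i L, a j * mlt i j := by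
    refine sum_comm' fun x y => ?_
    simp only [mem_Icc, mem_Ico, mem_Ioc]
    omega
  have row : ∀ i ∈ Ico 1 L, ∑ j ∈ Ioc i L, a j * mlt i j ≤ a i * d i := by
    intro i hi
    rw [mem_Ico] at hi
    calc ∑ j ∈ Ioc i L, a j * mlt i j
        ≤ ∑ j ∈ Ioc i L, if arrow j i then a j * d i else 0 := by
          refine sum_le_sum fun j hj => ?_
          rw [mem_Ioc] at hj
          split_ifs with h
          · exact mul_le_mul_of_nonneg_left (hyp2 i j hi.1 hj.1 hj.2) (ha j (by omega) hj.2)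
          · have h0 : mlt i j ≤ 0 := not_lt.mp fun hpos => h (hyp3 i j hi.1 hj.1 hj.2 hpos)
            exact mul_nonpos_of_nonneg_of_nonpos (ha j (by omega) hj.2) h0
      _ ≤ ∑ j ∈ Icc 1 L, if arrow j i then a j * d i else 0 := by
          refine sum_le_sum_of_subset_of_nonneg (fun j hj => ?_) fun j hj _ => ?_
          · rw [mem_Ioc] at hj
            exact mem_Icc.mpr ⟨by omega, hj.2⟩
          · rw [mem_Icc] at hj
            split_ifs
            · exact mul_nonneg (ha j hj.1 hj.2) (hd i hi.1 hi.2.le)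
            · exact le_rfl
      _ = (∑ j ∈ (Icc 1 L).filter (fun j => arrow j i), a j) * d i := by
          rw [← sum_filter, sum_mul]
      _ ≤ a i * d i :=
          mul_le_mul_of_nonneg_right (hcomp i hi.1 hi.2.le) (hd i hi.1 hi.2.le)
  have total : ∑ j ∈ Icc 1 L, a j * ν j ^ 2 + ∑ j ∈ Icc 1 L, a j * d j =
      ∑ j ∈ Icc 1 L, a j * mlt 0 j + ∑ j ∈ Icc 1 L, ∑ i ∈ Ico 1 j, a j * mlt i j := by
    rw [← sum_add_distrib, ← sum_add_distrib]
    refine sum_congr rfl fun j hj => ?_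
    rw [mem_Icc] at hj
    rw [← mul_add, hyp1 j hj.1 hj.2, ← mul_sum, ← mul_add, range_eq_Ico,
      sum_eq_sum_Ico_succ_bot (by omega)]
  have split : ∑ j ∈ Icc 1 L, a j * d j = a L * d L + ∑ j ∈ Ico 1 L, a j * d j := by
    rw [← Ico_insert_right hL, sum_insert right_notMem_Ico]
  have last := mul_le_mul_of_nonneg_left hyp4 (ha L hL le_rfl)
  linarith [sum_le_sum row]
end

section
/- Assume given resolution data: integers K ≥ L ≥ 1; a relation → on {1,…,K}; real numbers ν_1,…,ν_K; nonnegative real numbers d_1,…,d_L; and nonnegative real numbers m_{i,j} for 0 ≤ i < j ≤ L, such that (i) ν_j² + d_j = Σ_{i=0}^{j−1} m_{i,j} for each 1 ≤ j ≤ L, (ii) m_{i,j} ≤ d_i whenever 1 ≤ i < j ≤ L, (iii) whenever 1 ≤ i < j ≤ L and m_{i,j} > 0 one has j → i, and (iv) d_L ≥ Σ_{i=L+1}^K ν_i². Let a : {1,…,L} → ℝ be any nonnegative function compatible with the graph structure, i.e. a(i) ≥ Σ_{j ∈ {1,…,L}, j → i} a(j) for every i ∈ {1,…,L}. If m is a real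 number with m ≥ m_{0,i} for every i ∈ {1,…,L}, then m·(Σ_{i=1}^L a(i)) ≥ Σ_{i=1}^L a(i)·ν_i² + a(L)·Σ_{i=L+1}^K ν_i². -/
open Finset

/-- First corollary of the principal computation of the method of maximal
singularities: with the same resolution data as in the principal computation,
if `m` is a real number with `m ≥ m_{0,i}` for every `i ∈ {1,…,L}`, then
`m · (∑_{i=1}^{L} a i) ≥ ∑_{i=1}^{L} a i · ν_i² + a L · ∑_{i=L+1}^{K} ν_i²`. -/
theorem principal_computation_corollary_one
    (K L : ℕ) (hL : 1 ≤ L) (hKL : L ≤ K)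
    (arrow : ℕ → ℕ → Prop) [DecidableRel arrow]
    (ν : ℕ → ℝ) (d : ℕ → ℝ) (mlt : ℕ → ℕ → ℝ)
    (hd : ∀ i, 1 ≤ i → i ≤ L → 0 ≤ d i)
    (hmlt : ∀ i j, i < j → j ≤ L → 0 ≤ mlt i j)
    (hyp1 : ∀ j, 1 ≤ j → j ≤ L →
      ν j ^ 2 + d j = ∑ i ∈ Finset.range j, mlt i j)
    (hyp2 : ∀ i j, 1 ≤ i → i < j → j ≤ L → mlt i j ≤ d i)
    (hyp3 : ∀ i j, 1 ≤ i → i < j → j ≤ L → 0 < mlt i j → arrow j i)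
    (hyp4 : d L ≥ ∑ i ∈ Finset.Icc (L + 1) K, ν i ^ 2)
    (a : ℕ → ℝ)
    (ha : ∀ i, 1 ≤ i → i ≤ L → 0 ≤ a i)
    (hcomp : ∀ i, 1 ≤ i → i ≤ L →
      a i ≥ ∑ j ∈ (Finset.Icc 1 L).filter (fun j => arrow j i), a j)
    (m : ℝ) (hm : ∀ i, 1 ≤ i → i ≤ L → mlt 0 i ≤ m) :
    m * (∑ i ∈ Finset.Icc 1 L, a i) ≥
      ∑ i ∈ Finset.Icc 1 L, a i * ν i ^ 2 +
        a L * ∑ i ∈ Finset.Icc (L + 1) K, ν i ^ 2 := by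
  have hswap : ∑ j ∈ Icc 1 L, ∑ i ∈ Ico 1 j, a j * mlt i j =
      ∑ i ∈ Ico 1 L, ∑ j ∈ Ioc i L, a j * mlt i j :=
    Finset.sum_comm' fun j i => by
      simp only [mem_Icc, mem_Ico, mem_Ioc]
      omega
  have hbound : ∀ i ∈ Ico 1 L, ∑ j ∈ Ioc i L, a j * mlt i j ≤ a i * d i := by
    intro i hi
    obtain ⟨hi1, hiL⟩ := mem_Ico.mp hi
    have hdi := hd i hi1 hiL.le
    calc ∑ j ∈ Ioc i L, a j * mlt i j
        ≤ ∑ j ∈ Ioc i L, if arrow j i then a j * d i else 0 := by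
          refine sum_le_sum fun j hj => ?_
          obtain ⟨hij, hjL⟩ := mem_Ioc.mp hj
          have haj := ha j (by omega) hjL
          split_ifs with h
          · exact mul_le_mul_of_nonneg_left (hyp2 i j hi1 hij hjL) haj
          · exact mul_nonpos_of_nonneg_of_nonpos haj
              (not_lt.mp fun hpos => h (hyp3 i j hi1 hij hjL hpos))
      _ ≤ ∑ j ∈ Icc 1 L, if arrow j i then a j * d i else 0 := by
          refine sum_le_sum_of_subset_of_nonneg (fun j hj => ?_) fun j hj _ => ?_
          · simp only [mem_Icc, mem_Ioc] at hj ⊢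
            omega
          · obtain ⟨hj1, hjL⟩ := mem_Icc.mp hj
            split_ifs
            · exact mul_nonneg (ha j hj1 hjL) hdi
            · exact le_rfl
      _ = (∑ j ∈ (Icc 1 L).filter (fun j => arrow j i), a j) * d i := by
          rw [sum_mul, sum_filter]
      _ ≤ a i * d i := mul_le_mul_of_nonneg_right (hcomp i hi1 hiL.le) hdi
  have hrow : ∀ j ∈ Icc 1 L,
      a j * ν j ^ 2 + a j * d j ≤ m * a j + ∑ i ∈ Ico 1 j, a j * mlt i j := by
    intro j hj
    obtain ⟨hj1, hjL⟩ := mem_Icc.mp hj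
    have hsplit : ∑ i ∈ range j, mlt i j = mlt 0 j + ∑ i ∈ Ico 1 j, mlt i j := by
      rw [range_eq_Ico, sum_eq_sum_Ico_succ_bot (by omega)]
    rw [← mul_add, hyp1 j hj1 hjL, hsplit, mul_add, mul_sum, mul_comm m]
    gcongr
    · exact ha j hj1 hjL
    · exact hm j hj1 hjL
  have htotal := sum_le_sum hrow
  rw [sum_add_distrib, sum_add_distrib, ← mul_sum, hswap] at htotal
  have hlast : ∑ i ∈ Icc 1 L, a i * d i = ∑ i ∈ Ico 1 L, a i * d i + a L * d L := by
    rw [← Ico_add_one_right_eq_Icc, sum_Ico_succ_top hL]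
  have hupper := mul_le_mul_of_nonneg_left hyp4 (ha L hL le_rfl)
  linarith [sum_le_sum hbound]
end

section
/- Assume given resolution data: integers K ≥ L ≥ 1; a relation → on {1,…,K}; real numbers ν_1,…,ν_K; nonnegative real numbers d_1,…,d_L; and nonnegative real numbers m_{i,j} for 0 ≤ i < j ≤ L, such that (i) ν_j² + d_j = Σ_{i=0}^{j−1} m_{i,j} for each 1 ≤ j ≤ L, (ii) m_{i,j} ≤ d_i whenever 1 ≤ i < j ≤ L, (iii) whenever 1 ≤ i < j ≤ L and m_{i,j} > 0 one has j → i, and (iv) d_L ≥ Σ_{i=L+1}^K ν_i². Let r : {1,…,K} → ℝ be a nonnegative function whose restriction to {1,…,L} is compatible with the graph structure, i.e. r(i) ≥ Σ_{j ∈ {1,…,L}, j → i} r(j) for every i ∈ {1,…,L}, and suppose r(i) ≤ r(L) for every i ∈ {L+1,…,K}. If m is a real number with m ≥ m_{0,i} for every i ∈ {1,…,L}, then m·(Σ_{i=1}^L r(i)) ≥ Σ_{i=1}^K r(i)·ν_i². -/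
open Finset

/-- The edges of a relation compatible with `r` that carry the positive multiplicities `mlt i j`
bound the weighted sum of these multiplicities by `r i * d`. -/
theorem sum_mul_le_mul_of_compatible {ι : Type*} [LinearOrder ι] (s : Finset ι) (i : ι)
    (arrow : ι → ι → Prop) [DecidableRel arrow] (a r : ι → ℝ) (d : ℝ) (hd : 0 ≤ d)
    (hr : ∀ j ∈ s, 0 ≤ r j) (hle : ∀ j ∈ s, i < j → a j ≤ d)
    (harrow : ∀ j ∈ s, i < j → 0 < a j → arrow j i)
    (hcomp : ∑ j ∈ s.filter (fun j => arrow j i), r j ≤ r i) :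
    ∑ j ∈ s.filter (fun j => i < j), r j * a j ≤ r i * d := by
  refine le_trans ?_ (mul_le_mul_of_nonneg_right hcomp hd)
  rw [Finset.sum_mul, Finset.sum_filter, Finset.sum_filter]
  refine Finset.sum_le_sum fun j hj => ?_
  have hrd : 0 ≤ r j * d := mul_nonneg (hr j hj) hd
  by_cases hij : i < j
  · rw [if_pos hij]
    by_cases ha : 0 < a j
    · rw [if_pos (harrow j hj hij ha)]
      exact mul_le_mul_of_nonneg_left (hle j hj hij) (hr j hj)
    · have := mul_nonpos_of_nonneg_of_nonpos (hr j hj) (not_lt.mp ha)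
      split_ifs <;> linarith
  · rw [if_neg hij]
    split_ifs <;> simp [hrd]

/-- Splitting off the index `0` and exchanging the order of summation in a sum over pairs
`i < j ≤ L`. -/
theorem sum_Icc_mul_sum_range (L : ℕ) (r : ℕ → ℝ) (a : ℕ → ℕ → ℝ) :
    ∑ j ∈ Finset.Icc 1 L, r j * ∑ i ∈ Finset.range j, a i j =
      ∑ j ∈ Finset.Icc 1 L, r j * a 0 j +
        ∑ i ∈ Finset.Icc 1 L, ∑ j ∈ (Finset.Icc 1 L).filter (fun j => i < j), r j * a i j := by
  have hswap : ∑ i ∈ Finset.Icc 1 L, ∑ j ∈ (Finset.Icc 1 L).filter (fun j => i < j), r j * a i j =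
      ∑ j ∈ Finset.Icc 1 L, ∑ i ∈ Finset.Ico 1 j, r j * a i j := by
    refine Finset.sum_comm' fun i j => ?_
    simp only [Finset.mem_Icc, Finset.mem_filter, Finset.mem_Ico]
    omega
  rw [hswap, ← Finset.sum_add_distrib]
  refine Finset.sum_congr rfl fun j hj => ?_
  rw [Finset.range_eq_Ico, Finset.sum_eq_sum_Ico_succ_bot (Finset.mem_Icc.mp hj).1, mul_add,
    Finset.mul_sum]

/-- Second corollary of the principal computation of the method of maximal
singularities (with `r i = p(K,i)` the path counts of the resolution graph):
with the same resolution data as in the principal computation, if `r` is a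
nonnegative function on `{1,…,K}` whose restriction to `{1,…,L}` is compatible
with the graph structure and `r i ≤ r L` for `L+1 ≤ i ≤ K`, and `m ≥ m_{0,i}`
for every `i ∈ {1,…,L}`, then `m · (∑_{i=1}^{L} r i) ≥ ∑_{i=1}^{K} r i · ν_i²`. -/
theorem principal_computation_corollary_two
    (K L : ℕ) (hL : 1 ≤ L) (hKL : L ≤ K)
    (arrow : ℕ → ℕ → Prop) [DecidableRel arrow]
    (ν : ℕ → ℝ) (d : ℕ → ℝ) (mlt : ℕ → ℕ → ℝ)
    (hd : ∀ i, 1 ≤ i → i ≤ L → 0 ≤ d i)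
    (hmlt : ∀ i j, i < j → j ≤ L → 0 ≤ mlt i j)
    (hyp1 : ∀ j, 1 ≤ j → j ≤ L →
      ν j ^ 2 + d j = ∑ i ∈ Finset.range j, mlt i j)
    (hyp2 : ∀ i j, 1 ≤ i → i < j → j ≤ L → mlt i j ≤ d i)
    (hyp3 : ∀ i j, 1 ≤ i → i < j → j ≤ L → 0 < mlt i j → arrow j i)
    (hyp4 : d L ≥ ∑ i ∈ Finset.Icc (L + 1) K, ν i ^ 2)
    (r : ℕ → ℝ)
    (hr : ∀ i, 1 ≤ i → i ≤ K → 0 ≤ r i)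
    (hcomp : ∀ i, 1 ≤ i → i ≤ L →
      r i ≥ ∑ j ∈ (Finset.Icc 1 L).filter (fun j => arrow j i), r j)
    (hupper : ∀ i, L + 1 ≤ i → i ≤ K → r i ≤ r L)
    (m : ℝ) (hm : ∀ i, 1 ≤ i → i ≤ L → mlt 0 i ≤ m) :
    m * (∑ i ∈ Finset.Icc 1 L, r i) ≥ ∑ i ∈ Finset.Icc 1 K, r i * ν i ^ 2 := by
  have hLmem : L ∈ Finset.Icc 1 L := Finset.mem_Icc.mpr ⟨hL, le_rfl⟩
  have hr' : ∀ j ∈ Finset.Icc 1 L, 0 ≤ r j := fun j hj =>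
    hr j (Finset.mem_Icc.mp hj).1 ((Finset.mem_Icc.mp hj).2.trans hKL)
  have hupp : ∑ i ∈ Finset.Icc (L + 1) K, r i * ν i ^ 2 ≤ r L * d L := by
    refine le_trans ?_ (mul_le_mul_of_nonneg_left hyp4 (hr L hL hKL))
    rw [Finset.mul_sum]
    refine Finset.sum_le_sum fun i hi => ?_
    rw [Finset.mem_Icc] at hi
    exact mul_le_mul_of_nonneg_right (hupper i hi.1 hi.2) (sq_nonneg _)
  have hcross : ∑ i ∈ Finset.Icc 1 L,
      ∑ j ∈ (Finset.Icc 1 L).filter (fun j => i < j), r j * mlt i j ≤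
        ∑ i ∈ Finset.Icc 1 L, r i * d i - r L * d L := by
    rw [← Finset.add_sum_erase _ _ hLmem, ← Finset.add_sum_erase _ (fun i => r i * d i) hLmem,
      add_sub_cancel_left, Finset.filter_false_of_mem
        fun j hj => not_lt.mpr (Finset.mem_Icc.mp hj).2, Finset.sum_empty, zero_add]
    refine Finset.sum_le_sum fun i hi => ?_
    obtain ⟨hi1, hiL⟩ := Finset.mem_Icc.mp (Finset.mem_of_mem_erase hi)
    exact sum_mul_le_mul_of_compatible _ i arrow (mlt i) r (d i) (hd i hi1 hiL) hr'
      (fun j hj hij => hyp2 i j hi1 hij (Finset.mem_Icc.mp hj).2)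
      (fun j hj hij => hyp3 i j hi1 hij (Finset.mem_Icc.mp hj).2) (hcomp i hi1 hiL)
  have hbase : ∑ j ∈ Finset.Icc 1 L, r j * mlt 0 j ≤ m * ∑ j ∈ Finset.Icc 1 L, r j := by
    rw [mul_comm, Finset.sum_mul]
    refine Finset.sum_le_sum fun j hj => mul_le_mul_of_nonneg_left ?_ (hr' j hj)
    exact hm j (Finset.mem_Icc.mp hj).1 (Finset.mem_Icc.mp hj).2
  have htotal : ∑ j ∈ Finset.Icc 1 L, r j * ν j ^ 2 + ∑ j ∈ Finset.Icc 1 L, r j * d j =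
      ∑ j ∈ Finset.Icc 1 L, r j * ∑ i ∈ Finset.range j, mlt i j := by
    rw [← Finset.sum_add_distrib]
    refine Finset.sum_congr rfl fun j hj => ?_
    rw [← hyp1 j (Finset.mem_Icc.mp hj).1 (Finset.mem_Icc.mp hj).2, mul_add]
  have hsplit : ∑ i ∈ Finset.Icc 1 K, r i * ν i ^ 2 =
      ∑ i ∈ Finset.Icc 1 L, r i * ν i ^ 2 + ∑ i ∈ Finset.Icc (L + 1) K, r i * ν i ^ 2 := by
    simp only [← Finset.Ico_add_one_right_eq_Icc]
    exact (Finset.sum_Ico_consecutive _ (by omega) (by omega)).symm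
  rw [sum_Icc_mul_sum_range] at htotal
  linarith
end

section
/- Let K ≥ L ≥ 1 be integers, n > 0 and m real numbers, r_1,…,r_K positive real numbers and ν_1,…,ν_K nonnegative real numbers. Set Σ_0 = Σ_{i=1}^L r_i and Σ_1 = Σ_{i=L+1}^K r_i. Assume the maximal-singularity inequality Σ_{i=1}^K r_i·ν_i > n·(2Σ_0 + Σ_1) and the intersection bound m·Σ_0 ≥ Σ_{i=1}^K r_i·ν_i². Then m·Σ_0·(Σ_0 + Σ_1) > n²·(2Σ_0 + Σ_1)², and consequently m > 4n². -/
/-- **The Iskovskikh–Manin corollary** (numerical form): let `K ≥ L ≥ 1`,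
`n > 0`, `m` real, `r₁,…,r_K > 0`, `ν₁,…,ν_K ≥ 0`, and set
`Σ₀ = ∑_{i=1}^{L} rᵢ`, `Σ₁ = ∑_{i=L+1}^{K} rᵢ`. If the maximal-singularity
inequality `∑ rᵢνᵢ > n(2Σ₀ + Σ₁)` and the intersection bound
`m·Σ₀ ≥ ∑ rᵢνᵢ²` hold, then `m·Σ₀·(Σ₀ + Σ₁) > n²(2Σ₀ + Σ₁)²`, and
consequently `m > 4n²`. -/
theorem iskovskikh_manin_inequality
    (K L : ℕ) (hL : 1 ≤ L) (hKL : L ≤ K)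
    (n m : ℝ) (hn : 0 < n)
    (r ν : ℕ → ℝ)
    (hr : ∀ i, 1 ≤ i → i ≤ K → 0 < r i)
    (hν : ∀ i, 1 ≤ i → i ≤ K → 0 ≤ ν i)
    (hmax : ∑ i ∈ Finset.Icc 1 K, r i * ν i >
      n * (2 * (∑ i ∈ Finset.Icc 1 L, r i) + ∑ i ∈ Finset.Icc (L + 1) K, r i))
    (hbound : m * (∑ i ∈ Finset.Icc 1 L, r i) ≥
      ∑ i ∈ Finset.Icc 1 K, r i * ν i ^ 2) :
    m * (∑ i ∈ Finset.Icc 1 L, r i) *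
        ((∑ i ∈ Finset.Icc 1 L, r i) + ∑ i ∈ Finset.Icc (L + 1) K, r i) >
      n ^ 2 * (2 * (∑ i ∈ Finset.Icc 1 L, r i) +
        ∑ i ∈ Finset.Icc (L + 1) K, r i) ^ 2 ∧
    m > 4 * n ^ 2 := by
  have hsplit : ∑ i ∈ Finset.Icc 1 K, r i =
      (∑ i ∈ Finset.Icc 1 L, r i) + ∑ i ∈ Finset.Icc (L + 1) K, r i := by
    rw [← Finset.sum_union]
    · congr 1
      ext i
      simp only [Finset.mem_union, Finset.mem_Icc]
      omega
    · rw [Finset.disjoint_left]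
      intro i
      simp only [Finset.mem_Icc]
      omega
  have hcs : (∑ i ∈ Finset.Icc 1 K, r i * ν i) ^ 2 ≤
      (∑ i ∈ Finset.Icc 1 K, r i) * ∑ i ∈ Finset.Icc 1 K, r i * ν i ^ 2 := by
    refine Finset.sum_sq_le_sum_mul_sum_of_sq_le_mul _ (fun i hi => ?_) (fun i hi => ?_)
      (fun i _ => le_of_eq (by ring))
    all_goals
      have hri := hr i (Finset.mem_Icc.1 hi).1 (Finset.mem_Icc.1 hi).2
      positivity
  have h0 : 0 < ∑ i ∈ Finset.Icc 1 L, r i :=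
    Finset.sum_pos
      (fun i hi => hr i (Finset.mem_Icc.1 hi).1 ((Finset.mem_Icc.1 hi).2.trans hKL))
      ⟨1, Finset.mem_Icc.2 ⟨le_rfl, hL⟩⟩
  have h1 : 0 ≤ ∑ i ∈ Finset.Icc (L + 1) K, r i :=
    Finset.sum_nonneg fun i hi =>
      (hr i (by have := (Finset.mem_Icc.1 hi).1; omega) (Finset.mem_Icc.1 hi).2).le
  rw [hsplit] at hcs
  generalize ∑ i ∈ Finset.Icc 1 L, r i = a at *
  generalize ∑ i ∈ Finset.Icc (L + 1) K, r i = b at *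
  have hab : 0 < a + b := by linarith
  have hmain : n ^ 2 * (2 * a + b) ^ 2 < m * a * (a + b) := by
    calc n ^ 2 * (2 * a + b) ^ 2 = (n * (2 * a + b)) ^ 2 := by ring
      _ < (∑ i ∈ Finset.Icc 1 K, r i * ν i) ^ 2 := by gcongr
      _ ≤ (a + b) * ∑ i ∈ Finset.Icc 1 K, r i * ν i ^ 2 := hcs
      _ ≤ (a + b) * (m * a) := by gcongr
      _ = m * a * (a + b) := by ring
  refine ⟨hmain, lt_of_mul_lt_mul_right ?_ (mul_pos h0 hab).le⟩
  calc 4 * n ^ 2 * (a * (a + b)) ≤ n ^ 2 * (2 * a + b) ^ 2 := by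
        nlinarith [sq_nonneg (n * b)]
    _ < m * (a * (a + b)) := by linarith
end
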